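/- Let ℓ ≥ 3 be an odd integer. For every x ∈ O₂ with normSq(x) = 1 and normSq(x - 1) ∈ 2ℤ₂ (i.e. x lies in the norm-one subgroup of the 2-Sylow subgroup of the Morava stabilizer group), and for every natural number n, there exists γ ∈ ℍ[ℚ] such that: γ ∈ O[1/ℓ], normSq(γ) = 1, the 2-adic valuation of the rational number normSq(γ - 1) is at least 1, and x - ι(γ) ∈ 2ⁿ·O₂ (i.e. x - ι(γ) = 2ⁿ·y for some y ∈ O₂). (This expresses that the group Λ of norm-one quasi-endomorphisms congruent to 1 modulo the maximal ideal is dense in Sl⁰₂.) -/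

import Mathlib

open Quaternion

/-- The Hurwitz quaternions: the subring of `ℍ[ℚ]` generated by `i`, `j` and
`ω = (1 + i + j + k)/2`. -/
noncomputable def HurwitzOrder : Subring ℍ[ℚ] :=
  Subring.closure {(⟨0, 1, 0, 0⟩ : ℍ[ℚ]), ⟨0, 0, 1, 0⟩, ⟨1/2, 1/2, 1/2, 1/2⟩}

/-- `O[1/ℓ]`: the subring of `ℍ[ℚ]` generated by the Hurwitz order and `1/ℓ`. -/
noncomputable def HurwitzOrderInvLoc (ℓ : ℕ) : Subring ℍ[ℚ] :=
  Subring.closure ((HurwitzOrder : Set ℍ[ℚ]) ∪ {((ℓ : ℚ)⁻¹ : ℚ) • (1 : ℍ[ℚ])})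

/-- The maximal order `O₂` of the quaternion algebra `ℍ[ℚ₂]`: the subring generated
by `ℤ₂`, `i`, `j`, and `ω = (1 + i + j + k)/2`.  Its unit group is the second Morava
stabilizer group at `p = 2`. -/
noncomputable def MaximalOrderQ2 : Subring ℍ[ℚ_[2]] :=
  Subring.closure
    ({(⟨0, 1, 0, 0⟩ : ℍ[ℚ_[2]]), ⟨0, 0, 1, 0⟩, ⟨1/2, 1/2, 1/2, 1/2⟩} ∪
      {x : ℍ[ℚ_[2]] | ∃ z : ℤ_[2], x = algebraMap ℚ_[2] ℍ[ℚ_[2]] (z : ℚ_[2])})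

/-- The coordinatewise inclusion `ℍ[ℚ] → ℍ[ℚ₂]`. -/
noncomputable def iotaQ2 : ℍ[ℚ] → ℍ[ℚ_[2]] :=
  fun x => ⟨(x.re : ℚ_[2]), (x.imI : ℚ_[2]), (x.imJ : ℚ_[2]), (x.imK : ℚ_[2])⟩

/-- Translating by a multiple of `B` brings `P` into the interval `[-B/2, B/2]`. -/
lemma exists_two_mul_add_mul_le (P B : ℤ) (hB : 0 < B) :
    ∃ k : ℤ, -B ≤ 2 * (P + k * B) ∧ 2 * (P + k * B) ≤ B := by
  refine ⟨-((2 * P + B) / (2 * B)), ?_⟩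
  have h1 := Int.emod_add_mul_ediv (2 * P + B) (2 * B)
  have h2 := Int.emod_nonneg (2 * P + B) (show 2 * B ≠ 0 by positivity)
  have h3 := Int.emod_lt_of_pos (2 * P + B) (show 0 < 2 * B by positivity)
  constructor <;> linarith

lemma eq_one_of_hermite_bounds {a B : ℤ} (ha : 0 < a) (h₁ : 3 * B ^ 2 ≤ 4 * a)
    (h₂ : 3 * a ^ 2 ≤ 4 * B) : a = 1 := by
  by_contra hne
  have h2 : 2 ≤ a := by lia
  have : (3 * a ^ 2) ^ 2 ≤ (4 * B) ^ 2 := by gcongr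
  nlinarith [pow_le_pow_left₀ (by norm_num) h2 3]

/-- A positive definite integral ternary quadratic form of determinant one takes only
values that are sums of three squares. -/
theorem ternary_form_eq_sum_three_sq (a b c p q r : ℤ) (ha : 0 < a) (hB : 0 < a * b - r ^ 2)
    (hdet : a * (b * c - p ^ 2) - r * (r * c - p * q) + q * (r * p - b * q) = 1) (x y z : ℤ) :
    ∃ u v w : ℤ, a * x ^ 2 + b * y ^ 2 + c * z ^ 2 + 2 * p * (y * z) + 2 * q * (x * z) +
      2 * r * (x * y) = u ^ 2 + v ^ 2 + w ^ 2 := by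
  obtain ⟨k, hk1, hk2⟩ := exists_two_mul_add_mul_le (a * p - r * q) (a * b - r ^ 2) hB
  obtain ⟨c', hc'⟩ : ∃ c', c' = c + 2 * k * p + k ^ 2 * b := ⟨_, rfl⟩
  obtain ⟨p', hp'⟩ : ∃ p', p' = p + k * b := ⟨_, rfl⟩
  obtain ⟨q', hq'⟩ : ∃ q', q' = q + k * r := ⟨_, rfl⟩
  have hP : a * p - r * q + k * (a * b - r ^ 2) = a * p' - r * q' := by subst_vars; ring
  rw [hP] at hk1 hk2
  clear hP
  have hBC : (a * b - r ^ 2) * (a * c' - q' ^ 2) = a + (a * p' - r * q') ^ 2 := by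
    subst_vars; linear_combination a * hdet
  have hC : 0 < a * c' - q' ^ 2 := by
    have : 0 < (a * b - r ^ 2) * (a * c' - q' ^ 2) := by rw [hBC]; positivity
    exact pos_of_mul_pos_right this hB.le
  by_cases hlt : a * c' - q' ^ 2 < a * b - r ^ 2
  · obtain ⟨u, v, w, h⟩ := ternary_form_eq_sum_three_sq a c' b p' r q' ha hC
      (by subst_vars; linear_combination hdet) x z (y - k * z)
    exact ⟨u, v, w, by rw [← h]; subst_vars; ring⟩
  obtain ⟨l, hl1, hl2⟩ := exists_two_mul_add_mul_le r a ha
  obtain ⟨r', hr'⟩ : ∃ r', r' = r + l * a := ⟨_, rfl⟩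
  obtain ⟨b', hb'⟩ : ∃ b', b' = b + 2 * l * r + l ^ 2 * a := ⟨_, rfl⟩
  obtain ⟨p'', hp''⟩ : ∃ p'', p'' = p' + l * q' := ⟨_, rfl⟩
  rw [← hr'] at hl1 hl2
  have hB' : a * b - r ^ 2 = a * b' - r' ^ 2 := by subst_vars; ring
  have hb'pos : 0 < b' := by
    have : 0 < a * b' := by nlinarith [sq_nonneg r']
    exact pos_of_mul_pos_right this ha.le
  by_cases hlt' : b' < a
  · obtain ⟨u, v, w, h⟩ := ternary_form_eq_sum_three_sq b' a c' q' p'' r' hb'pos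
      (by rw [mul_comm]; exact hB' ▸ hB)
      (by subst_vars; linear_combination hdet) (y - k * z) (x - l * (y - k * z)) z
    exact ⟨u, v, w, by rw [← h]; subst_vars; ring⟩
  push Not at hlt hlt'
  have hBle : 3 * (a * b - r ^ 2) ^ 2 ≤ 4 * a := by nlinarith only [hlt, hBC, hk1, hk2, hB]
  have hage : 3 * a ^ 2 ≤ 4 * (a * b - r ^ 2) := by
    rw [hB']; nlinarith only [hlt', hl1, hl2, ha]
  obtain rfl := eq_one_of_hermite_bounds ha hBle hage
  have hB1 : 1 * b - r ^ 2 = 1 := by nlinarith only [hBle, hB]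
  refine ⟨x + r * y + q * z, y + (p - r * q) * z, z, ?_⟩
  have hb : b = 1 + r ^ 2 := by linarith
  subst hb
  linear_combination z ^ 2 * hdet
termination_by (a.toNat, (a * b - r ^ 2).toNat)
decreasing_by
  · exact Prod.Lex.right _ (by lia)
  · exact Prod.Lex.left _ _ (by lia)

/-- The case of Legendre's three-square theorem needed here. -/
theorem Int.exists_sum_three_sq_of_emod_four_eq_two (n : ℕ) (hn : n % 4 = 2) :
    ∃ u v w : ℤ, (n : ℤ) = u ^ 2 + v ^ 2 + w ^ 2 := by
  have hcop : (n - 1).Coprime (4 * n) := by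
    refine Nat.Coprime.mul_right ?_ ?_
    · have : (n - 1).Coprime 2 := Nat.coprime_two_right.2 (by rw [Nat.odd_iff]; lia)
      exact this.pow_right 2
    · exact (Nat.coprime_self_sub_left (by lia : 1 ≤ n)).2 (by simp)
  obtain ⟨p, hpn, hp, hmod⟩ :=
    Nat.forall_exists_prime_gt_and_modEq (4 * n) (by lia : 4 * n ≠ 0) hcop
  obtain ⟨k, hk⟩ := (Nat.modEq_iff_dvd' (by lia)).1 hmod.symm
  obtain ⟨d, hd⟩ : ∃ d, d = 4 * k + 1 := ⟨_, rfl⟩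
  have hpd : p + 1 = d * n := by
    have : p = 4 * n * k + (n - 1) := by lia
    rw [hd, this, add_assoc, Nat.sub_add_cancel (by lia)]; ring
  have hpd' : (p : ℤ) + 1 = d * n := by exact_mod_cast hpd
  have hp4 : p % 4 = 1 := by
    have : p = 4 * (n * k) + (n - 1) := by rw [← mul_assoc]; lia
    lia
  have : Fact p.Prime := ⟨hp⟩
  have hdodd : Odd d := by rw [Nat.odd_iff]; lia
  have hpodd : Odd p := by rw [Nat.odd_iff]; lia
  have hJ : jacobiSym (-(d : ℤ)) p = 1 := by
    rw [jacobiSym.neg _ hpodd, ZMod.χ₄_nat_one_mod_four hp4, one_mul,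
      ← jacobiSym.quadratic_reciprocity_one_mod_four hp4 hdodd,
      jacobiSym.mod_left' (a₂ := -1), jacobiSym.at_neg_one hdodd,
      ZMod.χ₄_nat_one_mod_four (by lia)]
    exact (Int.modEq_iff_dvd.2 ⟨-n, by linear_combination -hpd'⟩ : (p : ℤ) ≡ -1 [ZMOD d])
  obtain ⟨t, ht⟩ := ZMod.isSquare_of_jacobiSym_eq_one hJ
  obtain ⟨t, rfl⟩ := ZMod.intCast_surjective t
  have hdvd : (p : ℤ) ∣ t ^ 2 + d := by
    rw [← ZMod.intCast_zmod_eq_zero_iff_dvd]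
    push_cast at ht ⊢
    linear_combination -ht
  obtain ⟨s, hs⟩ := hdvd
  have hd0 : (0 : ℤ) < d := by lia
  have hs0 : 0 < s := by
    have : 0 < (p : ℤ) * s := by rw [← hs]; positivity
    exact pos_of_mul_pos_right this (by positivity)
  obtain ⟨u, v, w, h⟩ := ternary_form_eq_sum_three_sq s p n 0 1 t hs0
    (by linarith) (by linear_combination (-n : ℤ) * hs - hpd') 0 0 1
  exact ⟨u, v, w, by rw [← h]; ring⟩

/-- The square of an odd `ℓ ≥ 3` is a sum of four squares, of one odd number, two numbers
congruent to `2` modulo `4` and one multiple of `4`. -/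
theorem Int.exists_sq_eq_sum_four_sq (ℓ : ℕ) (hℓ : 3 ≤ ℓ) (hodd : Odd ℓ) :
    ∃ a b c d : ℤ, (ℓ : ℤ) ^ 2 =
      (2 * a + 1) ^ 2 + (2 * (2 * b + 1)) ^ 2 + (2 * (2 * c + 1)) ^ 2 + (4 * d) ^ 2 := by
  obtain ⟨a, n, hn, h⟩ : ∃ (a : ℤ) (n : ℕ), n % 4 = 2 ∧ (ℓ : ℤ) ^ 2 = (2 * a + 1) ^ 2 + 4 * n := by
    obtain ⟨k, rfl⟩ := hodd
    have h8 := Nat.even_mul_succ_self k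
    obtain ⟨m, hm⟩ := h8
    have hℓ2 : (2 * k + 1) ^ 2 = 8 * m + 1 := by nlinarith
    have hm0 : 0 < m := by nlinarith
    by_cases hm2 : m % 2 = 1
    · refine ⟨0, 2 * m, by lia, ?_⟩
      zify at hℓ2; push_cast; linarith
    · refine ⟨1, 2 * (m - 1), by lia, ?_⟩
      zify at hℓ2; push_cast [hm0]; linarith
  obtain ⟨u, v, w, huvw⟩ := Int.exists_sum_three_sq_of_emod_four_eq_two n hn
  rw [huvw] at h
  have hmod : (u ^ 2 + v ^ 2 + w ^ 2) % 4 = 2 := by lia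
  rcases Int.even_or_odd' u with ⟨u, rfl | rfl⟩ <;> rcases Int.even_or_odd' v with ⟨v, rfl | rfl⟩ <;>
    rcases Int.even_or_odd' w with ⟨w, rfl | rfl⟩ <;> ring_nf at hmod
  all_goals first
    | (exfalso; lia)
    | exact ⟨a, u, v, w, by rw [h]; ring1⟩
    | exact ⟨a, v, w, u, by rw [h]; ring1⟩
    | exact ⟨a, u, w, v, by rw [h]; ring1⟩

lemma PadicInt.two_parity (x : ℤ_[2]) : ∃ y, x = 2 * y ∨ x = 2 * y + 1 := by
  obtain ⟨n, hn, hx⟩ := PadicInt.exists_mem_range x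
  rw [PadicInt.maximalIdeal_eq_span_p, Ideal.mem_span_singleton] at hx
  obtain ⟨y, hy⟩ := hx
  refine ⟨y, ?_⟩
  push_cast at hy
  interval_cases n
  · left; simpa using hy
  · right; push_cast at hy; linear_combination hy

lemma PadicInt.two_mul_ne_one (y : ℤ_[2]) : 2 * y ≠ 1 := by
  intro h
  have := congrArg (PadicInt.toZMod (p := 2)) h
  rw [map_mul, map_ofNat, map_one, show (OfNat.ofNat 2 : ZMod 2) = 0 from rfl, zero_mul] at this
  exact zero_ne_one this

/-- If a sum of three squares is divisible by four, then so is each of them. -/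
lemma PadicInt.exists_eq_two_mul_of_sum_three_sq {p q u t : ℤ_[2]}
    (h : p ^ 2 + q ^ 2 + u ^ 2 = 4 * t) :
    ∃ p' q' u', p = 2 * p' ∧ q = 2 * q' ∧ u = 2 * u' := by
  have cancel {y : ℤ_[2]} (h : 4 * y = 2) : False :=
    two_mul_ne_one y (mul_left_cancel₀ two_ne_zero (by linear_combination h))
  obtain ⟨p, rfl | rfl⟩ := p.two_parity <;> obtain ⟨q, rfl | rfl⟩ := q.two_parity <;>
    obtain ⟨u, rfl | rfl⟩ := u.two_parity
  · exact ⟨p, q, u, rfl, rfl, rfl⟩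
  · exact (two_mul_ne_one (2 * (t - p ^ 2 - q ^ 2 - u ^ 2 - u)) (by linear_combination -h)).elim
  · exact (two_mul_ne_one (2 * (t - p ^ 2 - q ^ 2 - u ^ 2 - q)) (by linear_combination -h)).elim
  · exact (cancel (y := t - p ^ 2 - q ^ 2 - u ^ 2 - q - u) (by linear_combination -h)).elim
  · exact (two_mul_ne_one (2 * (t - p ^ 2 - q ^ 2 - u ^ 2 - p)) (by linear_combination -h)).elim
  · exact (cancel (y := t - p ^ 2 - q ^ 2 - u ^ 2 - p - u) (by linear_combination -h)).elim
  · exact (cancel (y := t - p ^ 2 - q ^ 2 - u ^ 2 - p - q) (by linear_combination -h)).elim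
  · exact (two_mul_ne_one (2 * (t - p ^ 2 - q ^ 2 - u ^ 2 - p - q - u) - 1)
      (by linear_combination -h)).elim

/-- The quaternion with given coordinates. -/
def Quaternion.ofCoords {R : Type*} [CommRing R] (a b c d : R) : ℍ[R] := ⟨a, b, c, d⟩

section OfCoords

variable {R : Type*} [CommRing R] (a b c d : R)

@[simp] lemma Quaternion.ofCoords_re : (ofCoords a b c d).re = a := rfl

@[simp] lemma Quaternion.ofCoords_imI : (ofCoords a b c d).imI = b := rfl

@[simp] lemma Quaternion.ofCoords_imJ : (ofCoords a b c d).imJ = c := rfl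

@[simp] lemma Quaternion.ofCoords_imK : (ofCoords a b c d).imK = d := rfl

end OfCoords

/-- Coordinatewise congruence of quaternions modulo a scalar. -/
def Quaternion.CongMod {R : Type*} [CommRing R] (c : R) (x y : ℍ[R]) : Prop :=
  ∃ w : ℍ[R], x = y + c • w

namespace Quaternion.CongMod

variable {R : Type*} [CommRing R] {c : R} {x y z x' y' : ℍ[R]}

lemma refl (x : ℍ[R]) : CongMod c x x := ⟨0, by simp⟩

lemma trans (h : CongMod c x y) (h' : CongMod c y z) : CongMod c x z := by
  obtain ⟨w, rfl⟩ := h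
  obtain ⟨w', rfl⟩ := h'
  exact ⟨w' + w, by rw [smul_add, add_assoc]⟩

lemma symm (h : CongMod c x y) : CongMod c y x := by
  obtain ⟨w, rfl⟩ := h
  exact ⟨-w, by rw [smul_neg]; abel⟩

lemma mul (h : CongMod c x y) (h' : CongMod c x' y') : CongMod c (x * x') (y * y') := by
  obtain ⟨w, rfl⟩ := h
  obtain ⟨w', rfl⟩ := h'
  refine ⟨w * y' + y * w' + c • (w * w'), ?_⟩
  simp only [add_mul, mul_add, smul_mul_assoc, mul_smul_comm, smul_add]
  abel

lemma neg (h : CongMod c x y) : CongMod c (-x) (-y) := by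
  obtain ⟨w, rfl⟩ := h
  exact ⟨-w, by rw [smul_neg]; abel⟩

lemma of_coords (h₁ : c ∣ x.re - y.re) (h₂ : c ∣ x.imI - y.imI) (h₃ : c ∣ x.imJ - y.imJ)
    (h₄ : c ∣ x.imK - y.imK) : CongMod c x y := by
  obtain ⟨a, ha⟩ := h₁
  obtain ⟨b, hb⟩ := h₂
  obtain ⟨d, hd⟩ := h₃
  obtain ⟨e, he⟩ := h₄
  refine ⟨ofCoords a b d e, ?_⟩
  ext
  · simpa using sub_eq_iff_eq_add'.1 ha
  · simpa using sub_eq_iff_eq_add'.1 hb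
  · simpa using sub_eq_iff_eq_add'.1 hd
  · simpa using sub_eq_iff_eq_add'.1 he

lemma sq_one_add {m : ℕ} (hm : 3 ≤ m) {g z : ℍ[ℤ_[2]]}
    (h : CongMod (2 ^ m) g (1 + (2 ^ (m - 1) : ℤ_[2]) • z)) :
    CongMod (2 ^ (m + 1)) (g * g) (1 + (2 ^ m : ℤ_[2]) • z) := by
  obtain ⟨k, rfl⟩ := Nat.exists_eq_add_of_le' hm
  obtain ⟨w, rfl⟩ := h
  have : (2 ^ (k + 3 - 1) : ℤ_[2]) • z + (2 ^ (k + 3) : ℤ_[2]) • w =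
      (2 ^ (k + 2) : ℤ_[2]) • (z + (2 : ℤ_[2]) • w) := by
    rw [smul_add, smul_smul, ← pow_succ]; rfl
  rw [add_assoc 1, this]
  refine ⟨w + (2 ^ k : ℤ_[2]) • ((z + (2 : ℤ_[2]) • w) * (z + (2 : ℤ_[2]) • w)), ?_⟩
  simp only [add_mul, mul_add, one_mul, mul_one, smul_mul_assoc, mul_smul_comm]
  module

end Quaternion.CongMod

lemma Quaternion.normSq_one_add_smul {R : Type*} [CommRing R] (c : R) (z : ℍ[R]) :
    normSq (1 + c • z) = 1 + 2 * c * z.re + c ^ 2 * normSq z := by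
  simp [normSq_def']; ring

section Approximation

variable {H : Submonoid ℍ[ℤ_[2]]}

/-- If the elements congruent to one modulo `2 ^ m` are reached by `H` modulo `2 ^ (m + 1)`,
then approximation modulo `2 ^ m` improves to approximation modulo `2 ^ (m + 1)`. -/
lemma exists_congMod_succ (hnorm : ∀ h ∈ H, normSq h = 1) {m : ℕ}
    (hm : 2 ≤ m)
    (hone : ∀ (z : ℍ[ℤ_[2]]) (s : ℤ_[2]), z.re = 2 * s →
      ∃ g ∈ H, CongMod (2 ^ (m + 1)) (1 + (2 ^ m : ℤ_[2]) • z) g)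
    {x : ℍ[ℤ_[2]]} {t : ℤ_[2]} (hx : normSq x = 1 + 2 ^ (m + 2) * t)
    (h : ∃ h ∈ H, CongMod (2 ^ m) x h) : ∃ h ∈ H, CongMod (2 ^ (m + 1)) x h := by
  obtain ⟨h, hh, hxh⟩ := h
  have hmul : star h * h = 1 := by rw [star_mul_self, hnorm h hh]; rfl
  have hmul' : h * star h = 1 := by rw [self_mul_star, hnorm h hh]; rfl
  obtain ⟨z, hz⟩ := hxh.mul (.refl (star h))
  rw [hmul'] at hz
  have hN := congrArg normSq hz
  rw [map_mul, normSq_star, hnorm h hh, mul_one, hx, normSq_one_add_smul] at hN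
  obtain ⟨k, rfl⟩ := Nat.exists_eq_add_of_le' hm
  have hre : z.re = 2 * (t - 2 ^ k * normSq z) := by
    have h2 : (2 ^ (k + 3) : ℤ_[2]) ≠ 0 := by simp
    apply mul_left_cancel₀ h2
    linear_combination -hN
  obtain ⟨g, hg, hgz⟩ := hone z _ hre
  refine ⟨g * h, mul_mem hg hh, ?_⟩
  rw [← hz] at hgz
  simpa [mul_assoc, hmul] using hgz.mul (.refl h)

/-- Approximation modulo `8` implies approximation modulo every power of `2`. -/
lemma exists_congMod_pow (hnorm : ∀ h ∈ H, normSq h = 1)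
    (h8 : ∀ (x : ℍ[ℤ_[2]]) (t : ℤ_[2]), normSq x = 1 + 2 ^ 4 * t → ∃ h ∈ H, CongMod (2 ^ 3) x h)
    {m : ℕ} (hm : 3 ≤ m) :
    ∀ (x : ℍ[ℤ_[2]]) (t : ℤ_[2]), normSq x = 1 + 2 ^ (m + 1) * t →
      ∃ h ∈ H, CongMod (2 ^ m) x h := by
  induction m, hm using Nat.le_induction with
  | base => exact h8
  | succ m hm ih =>
    intro x t hx
    refine exists_congMod_succ hnorm (by lia) (fun z s hz => ?_) hx
      (ih x (2 * t) (by rw [hx]; ring))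
    obtain ⟨g, hg, hgz⟩ := ih (1 + (2 ^ (m - 1) : ℤ_[2]) • z)
      (s + 2 ^ (m - 3) * normSq z) (by
        obtain ⟨k, rfl⟩ := Nat.exists_eq_add_of_le' hm
        rw [normSq_one_add_smul, hz, Nat.add_sub_cancel, show k + 3 - 1 = k + 2 from rfl]
        ring)
    exact ⟨g * g, mul_mem hg hg, (hgz.symm.sq_one_add hm).symm⟩

lemma neg_mem_of_i_mem (hi : ofCoords 0 1 0 0 ∈ H) {h : ℍ[ℤ_[2]]} (hh : h ∈ H) :
    -h ∈ H := by
  have : -h = (ofCoords 0 1 0 0) * (ofCoords 0 1 0 0) * h := by ext <;> simp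
  rw [this]
  exact mul_mem (mul_mem hi hi) hh

lemma exists_congMod_eight (hstar : ∀ h ∈ H, star h ∈ H) (hnorm : ∀ h ∈ H, normSq h = 1)
    (hi : ofCoords 0 1 0 0 ∈ H) (hj : ofCoords 0 0 1 0 ∈ H) {a b c d : ℤ_[2]}
    (h₁₂ : ofCoords (1 + 4 * a) (2 * (2 * b + 1)) (2 * (2 * c + 1)) (4 * d) ∈ H)
    (h₁₃ : ofCoords (1 + 4 * a) (2 * (2 * b + 1)) (4 * d) (2 * (2 * c + 1)) ∈ H)
    (h4 : ∀ (x : ℍ[ℤ_[2]]) (t : ℤ_[2]), normSq x = 1 + 2 ^ 3 * t → ∃ h ∈ H, CongMod (2 ^ 2) x h)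
    (x : ℍ[ℤ_[2]]) (t : ℤ_[2]) (hx : normSq x = 1 + 2 ^ 4 * t) :
    ∃ h ∈ H, CongMod (2 ^ 3) x h := by
  have hN := hnorm _ h₁₂
  simp only [normSq_def', ofCoords_re, ofCoords_imI, ofCoords_imJ, ofCoords_imK] at hN
  have hI : ∃ g ∈ H, CongMod (2 ^ 3 : ℤ_[2]) (1 + (4 : ℤ_[2]) • ofCoords 0 1 0 0) g := by
    refine ⟨_, mul_mem (mul_mem (mul_mem hj h₁₂) (hstar _ hj)) (hstar _ h₁₂), .of_coords ?_ ?_ ?_ ?_⟩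
    · refine ⟨(2 * b + 1) ^ 2 + 4 * d ^ 2, ?_⟩
      simp
      linear_combination -hN
    · refine ⟨1 + 2 * a + b + 4 * a * b + 2 * (2 * c + 1) * d, ?_⟩
      simp
      ring
    · refine ⟨0, ?_⟩
      simp
      ring
    · refine ⟨(1 + 4 * a) * d - (2 * b + 1) * (2 * c + 1), ?_⟩
      simp
      ring
  have hJ : ∃ g ∈ H, CongMod (2 ^ 3 : ℤ_[2]) (1 + (4 : ℤ_[2]) • ofCoords 0 0 1 0) g := by
    refine ⟨_, mul_mem (mul_mem (mul_mem hi h₁₂) (hstar _ hi)) (hstar _ h₁₂), .of_coords ?_ ?_ ?_ ?_⟩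
    · refine ⟨(2 * c + 1) ^ 2 + 4 * d ^ 2, ?_⟩
      simp
      linear_combination -hN
    · refine ⟨0, ?_⟩
      simp
      ring
    · refine ⟨1 + 2 * a + c + 4 * a * c - 2 * (2 * b + 1) * d, ?_⟩
      simp
      ring
    · refine ⟨(1 + 4 * a) * d + (2 * b + 1) * (2 * c + 1), ?_⟩
      simp
      ring
  have hK : ∃ g ∈ H, CongMod (2 ^ 3 : ℤ_[2]) (1 + (4 : ℤ_[2]) • ofCoords 0 0 0 1) g := by
    refine ⟨_, mul_mem (mul_mem (mul_mem hi h₁₃) (hstar _ hi)) (hstar _ h₁₃), .of_coords ?_ ?_ ?_ ?_⟩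
    · refine ⟨(2 * c + 1) ^ 2 + 4 * d ^ 2, ?_⟩
      simp
      linear_combination -hN
    · refine ⟨0, ?_⟩
      simp
      ring
    · refine ⟨(1 + 4 * a) * d - (2 * b + 1) * (2 * c + 1), ?_⟩
      simp
      ring
    · refine ⟨1 + 2 * a + c + 4 * a * c + 2 * (2 * b + 1) * d, ?_⟩
      simp
      ring
  have key (e : ℍ[ℤ_[2]]) (he : ∃ g ∈ H, CongMod (2 ^ 3 : ℤ_[2]) (1 + (4 : ℤ_[2]) • e) g)
      (r : ℤ_[2]) : ∃ g ∈ H, CongMod (2 ^ 3 : ℤ_[2]) (1 + (4 * r) • e) g := by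
    obtain ⟨s, rfl | rfl⟩ := r.two_parity
    · exact ⟨1, one_mem H, s • e, by module⟩
    · obtain ⟨g, hg, hge⟩ := he
      exact ⟨g, hg, .trans ⟨s • e, by module⟩ hge⟩
  refine exists_congMod_succ hnorm le_rfl (fun z s hz => ?_) hx
    (h4 x (2 * t) (by rw [hx]; ring))
  obtain ⟨g₁, hg₁, hc₁⟩ := key (ofCoords 0 1 0 0) hI z.imI
  obtain ⟨g₂, hg₂, hc₂⟩ := key (ofCoords 0 0 1 0) hJ z.imJ
  obtain ⟨g₃, hg₃, hc₃⟩ := key (ofCoords 0 0 0 1) hK z.imK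
  refine ⟨_, mul_mem (mul_mem hg₁ hg₂) hg₃, .trans ?_ ((hc₁.mul hc₂).mul hc₃)⟩
  refine .of_coords ⟨s + 8 * z.imI * z.imJ * z.imK, ?_⟩ ⟨-2 * z.imJ * z.imK, ?_⟩
    ⟨2 * z.imI * z.imK, ?_⟩ ⟨-2 * z.imI * z.imJ, ?_⟩
  · simp [hz]; ring
  · simp; ring
  · simp; ring
  · simp; ring

lemma exists_congMod_four_of_re_odd (hi : ofCoords 0 1 0 0 ∈ H) {a b c d : ℤ_[2]}
    (h₁₂ : ofCoords (1 + 4 * a) (2 * (2 * b + 1)) (2 * (2 * c + 1)) (4 * d) ∈ H)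
    (h₁₃ : ofCoords (1 + 4 * a) (2 * (2 * b + 1)) (4 * d) (2 * (2 * c + 1)) ∈ H)
    (h₂₃ : ofCoords (1 + 4 * a) (4 * d) (2 * (2 * b + 1)) (2 * (2 * c + 1)) ∈ H)
    {x : ℍ[ℤ_[2]]} {t s : ℤ_[2]} (hx : normSq x = 1 + 2 ^ 3 * t) (hs : x.re = 2 * s + 1) :
    ∃ h ∈ H, CongMod (2 ^ 2) x h := by
  wlog hse : ∃ r, s = 2 * r generalizing x s
  · obtain ⟨r, rfl | rfl⟩ := s.two_parity
    · exact (hse ⟨r, rfl⟩).elim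
    obtain ⟨h, hh, hc⟩ := this (x := -x) (s := 2 * (-r - 1)) (by rw [normSq_neg, hx])
      (by simp [hs]; ring) ⟨_, rfl⟩
    exact ⟨-h, neg_mem_of_i_mem hi hh, by simpa using hc.neg⟩
  obtain ⟨r, rfl⟩ := hse
  rw [normSq_def', hs] at hx
  obtain ⟨p, q, u, hp, hq, hu⟩ := PadicInt.exists_eq_two_mul_of_sum_three_sq
    (p := x.imI) (q := x.imJ) (u := x.imK) (t := 2 * (t - r - 2 * r ^ 2))
    (by linear_combination hx)
  have hsum : p ^ 2 + q ^ 2 + u ^ 2 = 2 * (t - r - 2 * r ^ 2) := by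
    rw [hp, hq, hu] at hx
    apply mul_left_cancel₀ (show (4 : ℤ_[2]) ≠ 0 by norm_num)
    linear_combination hx
  obtain ⟨p, rfl | rfl⟩ := p.two_parity <;> obtain ⟨q, rfl | rfl⟩ := q.two_parity <;>
    obtain ⟨u, rfl | rfl⟩ := u.two_parity
  · refine ⟨1, one_mem H, .of_coords ⟨r, ?_⟩ ⟨p, ?_⟩ ⟨q, ?_⟩ ⟨u, ?_⟩⟩ <;>
      simp [hs, hp, hq, hu] <;> ring
  · exact (PadicInt.two_mul_ne_one
      (t - r - 2 * r ^ 2 - 2 * (p ^ 2 + q ^ 2 + u ^ 2 + u)) (by linear_combination -hsum)).elim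
  · exact (PadicInt.two_mul_ne_one
      (t - r - 2 * r ^ 2 - 2 * (p ^ 2 + q ^ 2 + u ^ 2 + q)) (by linear_combination -hsum)).elim
  · refine ⟨_, h₂₃, .of_coords ⟨r - a, ?_⟩ ⟨p - d, ?_⟩ ⟨q - b, ?_⟩ ⟨u - c, ?_⟩⟩ <;>
      simp [hs, hp, hq, hu] <;> ring
  · exact (PadicInt.two_mul_ne_one
      (t - r - 2 * r ^ 2 - 2 * (p ^ 2 + q ^ 2 + u ^ 2 + p)) (by linear_combination -hsum)).elim
  · refine ⟨_, h₁₃, .of_coords ⟨r - a, ?_⟩ ⟨p - b, ?_⟩ ⟨q - d, ?_⟩ ⟨u - c, ?_⟩⟩ <;>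
      simp [hs, hp, hq, hu] <;> ring
  · refine ⟨_, h₁₂, .of_coords ⟨r - a, ?_⟩ ⟨p - b, ?_⟩ ⟨q - c, ?_⟩ ⟨u - d, ?_⟩⟩ <;>
      simp [hs, hp, hq, hu] <;> ring
  · exact (PadicInt.two_mul_ne_one
      (t - r - 2 * r ^ 2 - 2 * (p ^ 2 + q ^ 2 + u ^ 2 + p + q + u) - 1)
      (by linear_combination -hsum)).elim

lemma exists_congMod_four (hi : ofCoords 0 1 0 0 ∈ H) (hj : ofCoords 0 0 1 0 ∈ H)
    {a b c d : ℤ_[2]}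
    (h₁₂ : ofCoords (1 + 4 * a) (2 * (2 * b + 1)) (2 * (2 * c + 1)) (4 * d) ∈ H)
    (h₁₃ : ofCoords (1 + 4 * a) (2 * (2 * b + 1)) (4 * d) (2 * (2 * c + 1)) ∈ H)
    (h₂₃ : ofCoords (1 + 4 * a) (4 * d) (2 * (2 * b + 1)) (2 * (2 * c + 1)) ∈ H)
    (x : ℍ[ℤ_[2]]) (t : ℤ_[2]) (hx : normSq x = 1 + 2 ^ 3 * t) :
    ∃ h ∈ H, CongMod (2 ^ 2) x h := by
  have key (e : ℍ[ℤ_[2]]) (he : e ∈ H) (hee : e * e = -1) (hen : normSq e = 1)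
      (s : ℤ_[2]) (hs : (x * e).re = 2 * s + 1) : ∃ h ∈ H, CongMod (2 ^ 2) x h := by
    obtain ⟨h, hh, hc⟩ := exists_congMod_four_of_re_odd hi h₁₂ h₁₃ h₂₃ (x := x * e) (t := t)
      (by rw [map_mul, hx, hen, mul_one]) hs
    refine ⟨-(h * e), neg_mem_of_i_mem hi (mul_mem hh he), ?_⟩
    simpa [mul_assoc, hee] using (hc.mul (.refl e)).neg
  have hk : ofCoords 0 0 0 1 ∈ H := by
    convert mul_mem hi hj using 1
    ext <;> simp
  obtain ⟨s, hs | hs⟩ := x.re.two_parity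
  swap
  · exact exists_congMod_four_of_re_odd hi h₁₂ h₁₃ h₂₃ hx hs
  obtain ⟨p, hp | hp⟩ := x.imI.two_parity
  swap
  · exact key _ hi (by ext <;> simp) (by simp [normSq_def']) (-p - 1) (by simp [hp]; ring)
  obtain ⟨q, hq | hq⟩ := x.imJ.two_parity
  swap
  · exact key _ hj (by ext <;> simp) (by simp [normSq_def']) (-q - 1) (by simp [hq]; ring)
  obtain ⟨u, hu | hu⟩ := x.imK.two_parity
  swap
  · exact key _ hk (by ext <;> simp) (by simp [normSq_def']) (-u - 1) (by simp [hu]; ring)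
  rw [normSq_def', hs, hp, hq, hu] at hx
  exact (PadicInt.two_mul_ne_one (2 * (s ^ 2 + p ^ 2 + q ^ 2 + u ^ 2) - 4 * t)
    (by linear_combination hx)).elim

/-- A submonoid of norm-one quaternions which contains `i`, `j` and suitable elements
congruent to one modulo two is dense in the norm-one quaternions with coefficients in `ℤ_[2]`. -/
theorem exists_congMod_pow_of_normSq_eq_one (hstar : ∀ h ∈ H, star h ∈ H)
    (hnorm : ∀ h ∈ H, normSq h = 1)
    (hi : ofCoords 0 1 0 0 ∈ H) (hj : ofCoords 0 0 1 0 ∈ H) {a b c d : ℤ_[2]}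
    (h₁₂ : ofCoords (1 + 4 * a) (2 * (2 * b + 1)) (2 * (2 * c + 1)) (4 * d) ∈ H)
    (h₁₃ : ofCoords (1 + 4 * a) (2 * (2 * b + 1)) (4 * d) (2 * (2 * c + 1)) ∈ H)
    (h₂₃ : ofCoords (1 + 4 * a) (4 * d) (2 * (2 * b + 1)) (2 * (2 * c + 1)) ∈ H)
    (m : ℕ) {x : ℍ[ℤ_[2]]} (hx : normSq x = 1) : ∃ h ∈ H, CongMod (2 ^ (m + 3)) x h :=
  exists_congMod_pow hnorm (exists_congMod_eight hstar hnorm hi hj h₁₂ h₁₃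
    (exists_congMod_four hi hj h₁₂ h₁₃ h₂₃)) (Nat.le_add_left 3 m) x 0 (by simp [hx])

end Approximation

@[simp] lemma PadicInt.coe_two : ((2 : ℤ_[2]) : ℚ_[2]) = 2 := rfl

/-- The coordinatewise inclusion `ℍ[ℤ₂] → ℍ[ℚ₂]`. -/
noncomputable def intToQ2 (h : ℍ[ℤ_[2]]) : ℍ[ℚ_[2]] := ofCoords h.re h.imI h.imJ h.imK

section Coordinates

variable (x y : ℍ[ℤ_[2]]) (γ δ : ℍ[ℚ])

@[simp] lemma intToQ2_re : (intToQ2 x).re = x.re := rfl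

@[simp] lemma intToQ2_imI : (intToQ2 x).imI = x.imI := rfl

@[simp] lemma intToQ2_imJ : (intToQ2 x).imJ = x.imJ := rfl

@[simp] lemma intToQ2_imK : (intToQ2 x).imK = x.imK := rfl

@[simp] lemma iotaQ2_re : (iotaQ2 γ).re = γ.re := rfl

@[simp] lemma iotaQ2_imI : (iotaQ2 γ).imI = γ.imI := rfl

@[simp] lemma iotaQ2_imJ : (iotaQ2 γ).imJ = γ.imJ := rfl

@[simp] lemma iotaQ2_imK : (iotaQ2 γ).imK = γ.imK := rfl

lemma intToQ2_one : intToQ2 1 = 1 := by ext <;> simp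

lemma intToQ2_mul : intToQ2 (x * y) = intToQ2 x * intToQ2 y := by ext <;> simp

lemma intToQ2_star : intToQ2 (star x) = star (intToQ2 x) := by ext <;> simp

lemma iotaQ2_one : iotaQ2 1 = 1 := by ext <;> simp

lemma iotaQ2_mul : iotaQ2 (γ * δ) = iotaQ2 γ * iotaQ2 δ := by ext <;> simp

lemma iotaQ2_star : iotaQ2 (star γ) = star (iotaQ2 γ) := by ext <;> simp

lemma normSq_intToQ2 : normSq (intToQ2 x) = (normSq x : ℤ_[2]) := by simp [normSq_def']

lemma normSq_iotaQ2 : normSq (iotaQ2 γ) = (normSq γ : ℚ) := by simp [normSq_def']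

end Coordinates

lemma i_mem_hurwitzOrderInvLoc (ℓ : ℕ) : ofCoords 0 1 0 0 ∈ HurwitzOrderInvLoc ℓ :=
  Subring.subset_closure (.inl (Subring.subset_closure (.inl rfl)))

lemma j_mem_hurwitzOrderInvLoc (ℓ : ℕ) : ofCoords 0 0 1 0 ∈ HurwitzOrderInvLoc ℓ :=
  Subring.subset_closure (.inl (Subring.subset_closure (.inr (.inl rfl))))

lemma star_mem_of_mem_closure {S : Set ℍ[ℚ]} (hS : ∀ x ∈ S, star x ∈ Subring.closure S)
    {x : ℍ[ℚ]} (hx : x ∈ Subring.closure S) : star x ∈ Subring.closure S := by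
  induction hx using Subring.closure_induction with
  | mem x hx => exact hS x hx
  | zero => simp
  | one => simp
  | add x y _ _ hx hy => simpa using add_mem hx hy
  | neg x _ hx => simpa using neg_mem hx
  | mul x y _ _ hx hy => simpa using mul_mem hy hx

lemma star_mem_hurwitzOrder {x : ℍ[ℚ]} (hx : x ∈ HurwitzOrder) : star x ∈ HurwitzOrder := by
  refine star_mem_of_mem_closure (fun y hy => ?_) hx
  have hmem := Subring.subset_closure hy
  rcases hy with rfl | rfl | rfl
  · have h : star (ofCoords 0 1 0 0 : ℍ[ℚ]) = -ofCoords 0 1 0 0 := by ext <;> simp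
    exact (congrArg (· ∈ Subring.closure _) h).mpr (neg_mem hmem)
  · have h : star (ofCoords 0 0 1 0 : ℍ[ℚ]) = -ofCoords 0 0 1 0 := by ext <;> simp
    exact (congrArg (· ∈ Subring.closure _) h).mpr (neg_mem hmem)
  · have h : star (ofCoords (1 / 2) (1 / 2) (1 / 2) (1 / 2) : ℍ[ℚ]) =
        1 - ofCoords (1 / 2) (1 / 2) (1 / 2) (1 / 2) := by ext <;> norm_num
    exact (congrArg (· ∈ Subring.closure _) h).mpr (sub_mem (one_mem _) hmem)

lemma star_mem_hurwitzOrderInvLoc {ℓ : ℕ} {x : ℍ[ℚ]} (hx : x ∈ HurwitzOrderInvLoc ℓ) :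
    star x ∈ HurwitzOrderInvLoc ℓ := by
  refine star_mem_of_mem_closure (fun y hy => ?_) hx
  rcases hy with hy | rfl
  · exact Subring.subset_closure (.inl (star_mem_hurwitzOrder hy))
  · rw [Quaternion.star_smul, star_one]
    exact Subring.subset_closure (.inr rfl)

/-- Integral quaternions divided by `ℓ` belong to `O[1/ℓ]`. -/
lemma ofCoords_div_mem_hurwitzOrderInvLoc (ℓ : ℕ) (a b c d : ℤ) :
    ofCoords (a / ℓ : ℚ) (b / ℓ) (c / ℓ) (d / ℓ) ∈ HurwitzOrderInvLoc ℓ := by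
  have hi := i_mem_hurwitzOrderInvLoc ℓ
  have hj := j_mem_hurwitzOrderInvLoc ℓ
  have hℓ : ofCoords (ℓ : ℚ)⁻¹ 0 0 0 ∈ HurwitzOrderInvLoc ℓ := by
    refine Subring.subset_closure (.inr ?_)
    rw [Set.mem_singleton_iff]
    ext
    · rw [re_smul, re_one, smul_eq_mul, mul_one, ofCoords_re]
    · rw [imI_smul, imI_one, smul_zero, ofCoords_imI]
    · rw [imJ_smul, imJ_one, smul_zero, ofCoords_imJ]
    · rw [imK_smul, imK_one, smul_zero, ofCoords_imK]
  convert mul_mem hℓ (add_mem (add_mem (add_mem (zsmul_mem (one_mem _) a) (zsmul_mem hi b))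
    (zsmul_mem hj c)) (zsmul_mem (mul_mem hi hj) d)) using 1
  ext <;> simp <;> ring

/-- The norm-one quaternions over `ℤ₂` which come from `O[1/ℓ]`. -/
noncomputable def normOneSubmonoid (ℓ : ℕ) : Submonoid ℍ[ℤ_[2]] where
  carrier := {h | ∃ γ ∈ HurwitzOrderInvLoc ℓ, normSq γ = 1 ∧ intToQ2 h = iotaQ2 γ}
  one_mem' := ⟨1, one_mem _, by simp, by rw [intToQ2_one, iotaQ2_one]⟩
  mul_mem' := by
    rintro x y ⟨γ, hγ, hγ', hx⟩ ⟨δ, hδ, hδ', hy⟩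
    exact ⟨γ * δ, mul_mem hγ hδ, by rw [map_mul, hγ', hδ', mul_one],
      by rw [intToQ2_mul, iotaQ2_mul, hx, hy]⟩

lemma star_mem_normOneSubmonoid {ℓ : ℕ} {h : ℍ[ℤ_[2]]} (hh : h ∈ normOneSubmonoid ℓ) :
    star h ∈ normOneSubmonoid ℓ := by
  obtain ⟨γ, hγ, hγ', hx⟩ := hh
  exact ⟨star γ, star_mem_hurwitzOrderInvLoc hγ, by rw [normSq_star, hγ'],
    by rw [intToQ2_star, iotaQ2_star, hx]⟩

lemma normSq_eq_one_of_mem_normOneSubmonoid {ℓ : ℕ} {h : ℍ[ℤ_[2]]}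
    (hh : h ∈ normOneSubmonoid ℓ) : normSq h = 1 := by
  obtain ⟨γ, hγ, hγ', hx⟩ := hh
  have := congrArg normSq hx
  rw [normSq_intToQ2, normSq_iotaQ2, hγ'] at this
  exact PadicInt.ext (by simpa using this)

/-- Four integers whose squares sum to `ℓ ^ 2` define an element of `normOneSubmonoid ℓ`. -/
lemma ofCoords_mem_normOneSubmonoid {ℓ : ℕ} {u : ℤ_[2]} (hu : u * ℓ = 1) {a b c d : ℤ}
    (h : (ℓ : ℤ) ^ 2 = a ^ 2 + b ^ 2 + c ^ 2 + d ^ 2) :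
    ofCoords (u * a) (u * b) (u * c) (u * d) ∈ normOneSubmonoid ℓ := by
  have hℓ : ℓ ≠ 0 := by
    rintro rfl
    simp at hu
  have hu' : (u : ℚ_[2]) = (ℓ : ℚ_[2])⁻¹ :=
    eq_inv_of_mul_eq_one_left (by exact_mod_cast congrArg ((↑) : ℤ_[2] → ℚ_[2]) hu)
  have hℚ : (ℓ : ℚ) ^ 2 = a ^ 2 + b ^ 2 + c ^ 2 + d ^ 2 := by exact_mod_cast h
  refine ⟨_, ofCoords_div_mem_hurwitzOrderInvLoc ℓ a b c d, ?_, ?_⟩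
  · simp only [normSq_def', ofCoords_re, ofCoords_imI, ofCoords_imJ, ofCoords_imK]
    field_simp
    exact hℚ.symm
  · ext <;> simp [hu'] <;> ring

/-- For odd `ℓ ≥ 3`, the submonoid `normOneSubmonoid ℓ` is dense in the norm-one quaternions
over `ℤ₂`. -/
theorem exists_mem_normOneSubmonoid_congMod {ℓ : ℕ} (hℓ : 3 ≤ ℓ) (hodd : Odd ℓ) (m : ℕ)
    {x : ℍ[ℤ_[2]]} (hx : normSq x = 1) :
    ∃ h ∈ normOneSubmonoid ℓ, CongMod (2 ^ (m + 3)) x h := by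
  obtain ⟨A, B, C, D, hsum⟩ := Int.exists_sq_eq_sum_four_sq ℓ hℓ hodd
  obtain ⟨k, hk⟩ := hodd
  obtain ⟨u, hu⟩ : ∃ u : ℤ_[2], u * ℓ = 1 := by
    have : IsUnit (ℓ : ℤ_[2]) := by
      rw [PadicInt.isUnit_iff]
      exact PadicInt.norm_natCast_eq_one_iff.2 (by rw [Nat.coprime_two_left]; exact ⟨k, hk⟩)
    obtain ⟨v, hv⟩ := this
    exact ⟨(v⁻¹ : ℤ_[2]ˣ), by rw [← hv, Units.inv_mul]⟩
  obtain ⟨v, rfl | rfl⟩ := u.two_parity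
  · exact (PadicInt.two_mul_ne_one _ (by rw [← mul_assoc]; exact hu)).elim
  have hmem (a' : ℤ_[2]) (A' : ℤ) (hA' : (2 * v + 1) * A' = 1 + 4 * a')
      (hsum : (ℓ : ℤ) ^ 2 = A' ^ 2 + (2 * (2 * B + 1)) ^ 2 + (2 * (2 * C + 1)) ^ 2 + (4 * D) ^ 2) :
      ∃ h ∈ normOneSubmonoid ℓ, CongMod (2 ^ (m + 3)) x h := by
    apply exists_congMod_pow_of_normSq_eq_one (a := a') (b := v * (2 * B + 1) + B)
      (c := v * (2 * C + 1) + C) (d := (2 * v + 1) * D)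
      (fun _ => star_mem_normOneSubmonoid) (fun _ => normSq_eq_one_of_mem_normOneSubmonoid)
      ⟨_, i_mem_hurwitzOrderInvLoc ℓ, by simp [normSq_def'], by ext <;> simp⟩
      ⟨_, j_mem_hurwitzOrderInvLoc ℓ, by simp [normSq_def'], by ext <;> simp⟩ _ _ _ m hx
    · convert ofCoords_mem_normOneSubmonoid hu hsum using 2 <;> push_cast
      · exact hA'.symm
      all_goals ring
    · convert ofCoords_mem_normOneSubmonoid hu (hsum.trans (add_right_comm _ _ _))
        using 2 <;> push_cast
      · exact hA'.symm
      all_goals ring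
    · convert ofCoords_mem_normOneSubmonoid hu (a := A') (b := 4 * D) (c := 2 * (2 * B + 1))
        (d := 2 * (2 * C + 1)) (by rw [hsum]; ring) using 2 <;> push_cast
      · exact hA'.symm
      all_goals ring
  obtain ⟨w, hw | hw⟩ := (v + A).two_parity
  · refine hmem (w + v * A) (2 * A + 1) ?_ hsum
    push_cast
    linear_combination 2 * hw
  · refine hmem (-1 - w - v * A) (-(2 * A + 1)) ?_ (by rw [hsum]; ring)
    push_cast
    linear_combination -2 * hw

/-- Quaternions with coordinates in `ℤ₂` belong to `O₂`. -/
lemma intToQ2_mem_maximalOrderQ2 (x : ℍ[ℤ_[2]]) : intToQ2 x ∈ MaximalOrderQ2 := by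
  have hi : ofCoords 0 1 0 0 ∈ MaximalOrderQ2 := Subring.subset_closure (.inl (.inl rfl))
  have hj : ofCoords 0 0 1 0 ∈ MaximalOrderQ2 := Subring.subset_closure (.inl (.inr (.inl rfl)))
  have hz (z : ℤ_[2]) : algebraMap ℚ_[2] ℍ[ℚ_[2]] z ∈ MaximalOrderQ2 :=
    Subring.subset_closure (.inr ⟨z, rfl⟩)
  convert add_mem (add_mem (add_mem (hz x.re) (mul_mem (hz x.imI) hi)) (mul_mem (hz x.imJ) hj))
    (mul_mem (hz x.imK) (mul_mem hi hj)) using 1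
  ext <;> simp

/-- The coordinates of an element of `O₂` are half-integers which are congruent to each other. -/
lemma exists_coords_of_mem_maximalOrderQ2 {x : ℍ[ℚ_[2]]} (hx : x ∈ MaximalOrderQ2) :
    ∃ a b c d : ℤ_[2], x.re = a / 2 ∧ x.imI = a / 2 + b ∧ x.imJ = a / 2 + c ∧
      x.imK = a / 2 + d := by
  induction hx using Subring.closure_induction with
  | mem x hx =>
    rcases hx with (rfl | rfl | rfl) | ⟨z, rfl⟩
    · exact ⟨0, 1, 0, 0, by simp⟩
    · exact ⟨0, 0, 1, 0, by simp⟩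
    · exact ⟨1, 0, 0, 0, by simp⟩
    · exact ⟨2 * z, -z, -z, -z, by simp⟩
  | zero => exact ⟨0, 0, 0, 0, by simp⟩
  | one => exact ⟨2, -1, -1, -1, by simp⟩
  | add x y _ _ hx hy =>
    obtain ⟨a, b, c, d, h₀, h₁, h₂, h₃⟩ := hx
    obtain ⟨a', b', c', d', h₀', h₁', h₂', h₃'⟩ := hy
    refine ⟨a + a', b + b', c + c', d + d', ?_⟩
    simp [h₀, h₁, h₂, h₃, h₀', h₁', h₂', h₃']
    refine ⟨?_, ?_, ?_, ?_⟩ <;> ring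
  | neg x _ hx =>
    obtain ⟨a, b, c, d, h₀, h₁, h₂, h₃⟩ := hx
    refine ⟨-a, -b, -c, -d, ?_⟩
    simp [h₀, h₁, h₂, h₃]
    refine ⟨?_, ?_, ?_, ?_⟩ <;> ring
  | mul x y _ _ hx hy =>
    obtain ⟨a, b, c, d, h₀, h₁, h₂, h₃⟩ := hx
    obtain ⟨a', b', c', d', h₀', h₁', h₂', h₃'⟩ := hy
    refine ⟨-a * a' - a * (b' + c' + d') - a' * (b + c + d) - 2 * (b * b' + c * c' + d * d'),
      a * a' + a * (b' + d') + a' * (b + c) + b * b' + c * c' + d * d' + c * d' - d * c',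
      a * a' + a * (b' + c') + a' * (c + d) + b * b' + c * c' + d * d' + d * b' - b * d',
      a * a' + a * (c' + d') + a' * (b + d) + b * b' + c * c' + d * d' + b * c' - c * b', ?_⟩
    simp [h₀, h₁, h₂, h₃, h₀', h₁', h₂', h₃']
    refine ⟨?_, ?_, ?_, ?_⟩ <;> ring

/-- An element of `O₂` of norm one which is congruent to one modulo the maximal ideal has
coordinates in `ℤ₂`. -/
lemma exists_intToQ2_eq {x : ℍ[ℚ_[2]]} (hx : x ∈ MaximalOrderQ2) (hnorm : normSq x = 1)
    {z : ℤ_[2]} (hz : normSq (x - 1) = 2 * (z : ℚ_[2])) :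
    ∃ X : ℍ[ℤ_[2]], intToQ2 X = x := by
  obtain ⟨a, b, c, d, h₀, h₁, h₂, h₃⟩ := exists_coords_of_mem_maximalOrderQ2 hx
  have ha : (a / 2 : ℚ_[2]) = (1 - z : ℤ_[2]) := by
    rw [normSq_def'] at hnorm hz
    simp at hz
    rw [← h₀]
    push_cast
    linear_combination (hnorm - hz) / 2
  rw [ha] at h₀ h₁ h₂ h₃
  refine ⟨ofCoords (1 - z) (1 - z + b) (1 - z + c) (1 - z + d), ?_⟩
  ext <;> simp [*]

/-- **Density of `Λ` in `Sl⁰₂` at `p = 2`.**  For odd `ℓ ≥ 3`, every norm-one element of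
`O₂` congruent to `1` modulo the maximal ideal is approximated `2`-adically to arbitrary
precision by norm-one elements of `O[1/ℓ]` congruent to `1` modulo the maximal ideal. -/
theorem lambda_dense_in_Sl02 (ℓ : ℕ) (hℓ : 3 ≤ ℓ) (hodd : Odd ℓ)
    (x : ℍ[ℚ_[2]]) (hx : x ∈ MaximalOrderQ2) (hnorm : normSq x = 1)
    (hcong : ∃ z : ℤ_[2], normSq (x - 1) = 2 * (z : ℚ_[2])) (n : ℕ) :
    ∃ γ : ℍ[ℚ], γ ∈ HurwitzOrderInvLoc ℓ ∧ normSq γ = 1 ∧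
      (∃ z : ℤ_[2], ((normSq (γ - 1) : ℚ) : ℚ_[2]) = 2 * (z : ℚ_[2])) ∧
      ∃ y ∈ MaximalOrderQ2, x - iotaQ2 γ = 2 ^ n * y := by
  obtain ⟨z, hz⟩ := hcong
  obtain ⟨X, rfl⟩ := exists_intToQ2_eq hx hnorm hz
  rw [normSq_intToQ2] at hnorm
  obtain ⟨h, ⟨γ, hγ, hγ', hhγ⟩, w, rfl⟩ :=
    exists_mem_normOneSubmonoid_congMod hℓ hodd n (x := X) (PadicInt.ext (by simpa using hnorm))
  refine ⟨γ, hγ, hγ', ⟨1 - h.re, ?_⟩, intToQ2 ((2 ^ 3 : ℤ_[2]) • w),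
    intToQ2_mem_maximalOrderQ2 _, ?_⟩
  · have hre : (h.re : ℚ_[2]) = γ.re := congrArg (fun q => q.re) hhγ
    have hsub : normSq (γ - 1) = 2 * (1 - γ.re) := by
      rw [normSq_def'] at hγ' ⊢
      simp
      linear_combination hγ'
    rw [hsub]
    push_cast
    rw [hre]
  · have hmul (y : ℍ[ℚ_[2]]) : 2 ^ n * y = (2 ^ n : ℚ_[2]) • y := by
      rw [← Quaternion.coe_mul_eq_smul, Quaternion.coe_pow]; rfl
    rw [← hhγ, hmul]
    ext <;> simp <;> ring
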